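/- For every ε ∈ (0,1/2) there exists ρ ∈ (0,1) such that for every r ∈ (0,ρ] and every integer k ≥ 0 one has α_k(r) ≤ 1 and β_k(r) < ε. -/

import Mathlib

/-- s(h) := 2n + h + 2. -/
def sExp (n h : ℕ) : ℕ := 2 * n + h + 2

/-- ν(m,h) := ((m+2)·m + 1)·s(h). -/
def nuExp (n m h : ℕ) : ℕ := ((m + 2) * m + 1) * sExp n h

/-- σ_{m,j} := e^{−j−2} / (m+1). -/
noncomputable def sigm (m j : ℕ) : ℝ := Real.exp (-(j : ℝ) - 2) / (m + 1)

/-- α_k(r) := a₀(r)^{2^k} · ∏_{j=0}^{k−1} H^{2^{k−1−j}} · σ_{m,j}^{−ν(m,j)·2^{k−1−j}}. -/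
noncomputable def alphaSeq (n m : ℕ) (H : ℝ) (a₀ : ℝ → ℝ) (k : ℕ) (r : ℝ) : ℝ :=
  a₀ r ^ (2 ^ k) *
    ∏ j ∈ Finset.range k,
      H ^ (2 ^ (k - 1 - j)) * sigm m j ^ (-((nuExp n m j * 2 ^ (k - 1 - j) : ℕ) : ℤ))

/-- b₀(r) := H · σ_{m,0}^{−(m+1)·s(0)} · a₀(r). -/
noncomputable def bInit (n m : ℕ) (H : ℝ) (a₀ : ℝ → ℝ) (r : ℝ) : ℝ :=
  H * sigm m 0 ^ (-(((m + 1) * sExp n 0 : ℕ) : ℤ)) * a₀ r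

/-- β_k(r) := b₀(r)^{2^k} · ∏_{j=0}^{k−1} P^{2^{k−1−j}} · e^{γ(m,j)·2^{k−1−j}},
    with γ(m,j) = c₁·j + c₀. -/
noncomputable def betaSeq (n m : ℕ) (H P c₀ c₁ : ℝ) (a₀ : ℝ → ℝ) (k : ℕ) (r : ℝ) : ℝ :=
  bInit n m H a₀ r ^ (2 ^ k) *
    ∏ j ∈ Finset.range k,
      P ^ (2 ^ (k - 1 - j)) * Real.exp ((c₁ * j + c₀) * 2 ^ (k - 1 - j))

/-- A doubly exponential sequence `x ^ 2 ^ k` absorbs the iterated products of factors of at most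
Gaussian growth, provided `x` is small enough. -/
theorem pow_two_pow_mul_prod_le {A δ x : ℝ} {g : ℕ → ℝ} (hA : 0 ≤ A) (hδ₀ : 0 ≤ δ) (hδ₁ : δ ≤ 1)
    (hg₀ : ∀ j, 0 ≤ g j) (hg : ∀ j : ℕ, g j ≤ Real.exp (A * ((j : ℝ) + 1) ^ 2))
    (hx₀ : 0 ≤ x) (hx : x ≤ δ * Real.exp (-(6 * A))) (k : ℕ) :
    x ^ (2 ^ k) * ∏ j ∈ Finset.range k, g j ^ (2 ^ (k - 1 - j)) ≤ δ := by
  have hnonneg (k : ℕ) : 0 ≤ x ^ (2 ^ k) * ∏ j ∈ Finset.range k, g j ^ (2 ^ (k - 1 - j)) :=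
    mul_nonneg (pow_nonneg hx₀ _) (Finset.prod_nonneg fun j _ => pow_nonneg (hg₀ j) _)
  have hsucc (k : ℕ) :
      x ^ (2 ^ (k + 1)) * ∏ j ∈ Finset.range (k + 1), g j ^ (2 ^ (k + 1 - 1 - j)) =
        (x ^ (2 ^ k) * ∏ j ∈ Finset.range k, g j ^ (2 ^ (k - 1 - j))) ^ 2 * g k := by
    have hprod : ∏ j ∈ Finset.range k, g j ^ (2 ^ (k + 1 - 1 - j)) =
        (∏ j ∈ Finset.range k, g j ^ (2 ^ (k - 1 - j))) ^ 2 := by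
      rw [← Finset.prod_pow]
      refine Finset.prod_congr rfl fun j hj => ?_
      have hjk := Finset.mem_range.mp hj
      rw [← pow_mul, ← pow_succ, show k + 1 - 1 - j = k - 1 - j + 1 by omega]
    rw [Finset.prod_range_succ, hprod, show k + 1 - 1 - k = 0 by omega]
    ring
  have hbound : x ^ (2 ^ k) * ∏ j ∈ Finset.range k, g j ^ (2 ^ (k - 1 - j)) ≤
      δ * Real.exp (-(A * ((k : ℝ) ^ 2 + 4 * k + 6))) := by
    induction k with
    | zero => simpa [mul_comm] using hx
    | succ k ih =>
      rw [hsucc]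
      calc
        _ ≤ (δ * Real.exp (-(A * ((k : ℝ) ^ 2 + 4 * k + 6)))) ^ 2 *
            Real.exp (A * ((k : ℝ) + 1) ^ 2) :=
          mul_le_mul (pow_le_pow_left₀ (hnonneg k) ih 2) (hg k) (hg₀ k) (by positivity)
        _ = δ ^ 2 * Real.exp (-(A * (((k + 1 : ℕ) : ℝ) ^ 2 + 4 * ((k + 1 : ℕ) : ℝ) + 6))) := by
          rw [mul_pow, ← Real.exp_nat_mul, mul_assoc, ← Real.exp_add]
          push_cast
          ring_nf
        _ ≤ _ := by
          gcongr
          nlinarith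
  refine hbound.trans (mul_le_of_le_one_right hδ₀ (Real.exp_le_one_iff.mpr ?_))
  have : 0 ≤ A * ((k : ℝ) ^ 2 + 4 * k + 6) := by positivity
  linarith

theorem sigm_pos (m j : ℕ) : 0 < sigm m j := by
  unfold sigm
  positivity

theorem inv_sigm_le_exp (m j : ℕ) : (sigm m j)⁻¹ ≤ Real.exp ((m : ℝ) + j + 2) := by
  have hm := Real.add_one_le_exp (m : ℝ)
  rw [sigm, inv_div, div_eq_mul_inv, ← Real.exp_neg,
    show (m : ℝ) + j + 2 = m + -(-(j : ℝ) - 2) by ring, Real.exp_add]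
  gcongr

theorem mul_inv_sigm_pow_nuExp_le (n m : ℕ) {H : ℝ} (hH : 0 < H) (j : ℕ) :
    H * (sigm m j)⁻¹ ^ nuExp n m j ≤
      Real.exp ((H + ((m + 2) * m + 1) * (2 * n + 2) * (m + 2)) * ((j : ℝ) + 1) ^ 2) := by
  have hH' : H ≤ Real.exp H := by linarith [Real.add_one_le_exp H]
  have hj : (1 : ℝ) ≤ ((j : ℝ) + 1) ^ 2 := one_le_pow₀ (by simp)
  calc
    _ ≤ Real.exp H * Real.exp ((m : ℝ) + j + 2) ^ nuExp n m j := by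
      have := sigm_pos m j
      gcongr
      exact inv_sigm_le_exp m j
    _ = Real.exp (H + ((m + 2) * m + 1) * ((2 * n + j + 2) * (m + j + 2))) := by
      rw [← Real.exp_nat_mul, ← Real.exp_add, nuExp, sExp]
      push_cast
      ring_nf
    _ ≤ _ := by
      rw [Real.exp_le_exp]
      have h₁ : (2 * n + j + 2 : ℝ) ≤ (2 * n + 2) * (j + 1) := by
        nlinarith [show (0 : ℝ) ≤ n * j by positivity, (j.cast_nonneg : (0 : ℝ) ≤ j)]
      have h₂ : (m + j + 2 : ℝ) ≤ (m + 2) * (j + 1) := by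
        nlinarith [show (0 : ℝ) ≤ m * j by positivity, (j.cast_nonneg : (0 : ℝ) ≤ j)]
      have h₃ : (2 * n + j + 2 : ℝ) * (m + j + 2) ≤
          (2 * n + 2) * ((m + 2) * ((j : ℝ) + 1) ^ 2) :=
        (mul_le_mul h₁ h₂ (by positivity) (by positivity)).trans_eq (by ring)
      calc
        _ ≤ H * ((j : ℝ) + 1) ^ 2 +
            ((m + 2) * m + 1) * ((2 * n + 2) * ((m + 2) * ((j : ℝ) + 1) ^ 2)) :=
          add_le_add (le_mul_of_one_le_right hH.le hj)
            (mul_le_mul_of_nonneg_left h₃ (by positivity))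
        _ = _ := by ring

theorem mul_exp_affine_le {P c₁ : ℝ} (c₀ : ℝ) (hP : 0 < P) (hc₁ : 0 < c₁) (j : ℕ) :
    P * Real.exp (c₁ * j + c₀) ≤ Real.exp ((P + c₁ + |c₀|) * ((j : ℝ) + 1) ^ 2) := by
  have hj₀ : (0 : ℝ) ≤ j := j.cast_nonneg
  calc
    _ ≤ Real.exp P * Real.exp (c₁ * j + c₀) := by
      gcongr
      linarith [Real.add_one_le_exp P]
    _ = Real.exp (P + (c₁ * j + c₀)) := (Real.exp_add _ _).symm
    _ ≤ _ := by
      rw [Real.exp_le_exp]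
      have hj : (1 : ℝ) ≤ ((j : ℝ) + 1) ^ 2 := by nlinarith
      have h₁ := mul_le_mul_of_nonneg_left hj hP.le
      have h₂ := mul_le_mul_of_nonneg_left (show (j : ℝ) ≤ ((j : ℝ) + 1) ^ 2 by nlinarith) hc₁.le
      have h₃ := mul_le_mul_of_nonneg_left hj (abs_nonneg c₀)
      linarith [le_abs_self c₀]

theorem alphaSeq_eq (n m : ℕ) (H : ℝ) (a₀ : ℝ → ℝ) (k : ℕ) (r : ℝ) :
    alphaSeq n m H a₀ k r = a₀ r ^ (2 ^ k) *
      ∏ j ∈ Finset.range k, (H * (sigm m j)⁻¹ ^ nuExp n m j) ^ (2 ^ (k - 1 - j)) := by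
  simp only [alphaSeq, zpow_neg, zpow_natCast, mul_pow, pow_mul, inv_pow]

theorem betaSeq_eq (n m : ℕ) (H P c₀ c₁ : ℝ) (a₀ : ℝ → ℝ) (k : ℕ) (r : ℝ) :
    betaSeq n m H P c₀ c₁ a₀ k r = bInit n m H a₀ r ^ (2 ^ k) *
      ∏ j ∈ Finset.range k, (P * Real.exp (c₁ * j + c₀)) ^ (2 ^ (k - 1 - j)) := by
  rw [betaSeq]
  congr 1
  refine Finset.prod_congr rfl fun j _ => ?_
  rw [mul_pow, ← Real.exp_nat_mul]
  push_cast
  ring_nf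

/-- Lemma of Section 3.4.2, part (C): for every ε ∈ (0,1/2) there is
    ρ ∈ (0,1) such that for every r ∈ (0,ρ] and every k ≥ 0 one has α_k(r) ≤ 1 and
    β_k(r) < ε. -/
theorem exists_radius_alpha_le_one_beta_lt_eps (n m : ℕ) (hn : 1 ≤ n)
    (H P c₀ c₁ : ℝ) (hH : 0 < H) (hP : 0 < P) (hc₁ : 0 < c₁) (a₀ : ℝ → ℝ)
    (ha_nonneg : ∀ r : ℝ, 0 < r → r ≤ 1 → 0 ≤ a₀ r)
    (ha_mono : ∀ r₁ r₂ : ℝ, 0 < r₁ → r₁ ≤ r₂ → r₂ ≤ 1 → a₀ r₁ ≤ a₀ r₂)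
    (ha_lim : Filter.Tendsto a₀ (nhdsWithin 0 (Set.Ioi 0)) (nhds 0))
    (ε : ℝ) (hε : ε ∈ Set.Ioo (0 : ℝ) (1 / 2)) :
    ∃ ρ ∈ Set.Ioo (0 : ℝ) 1, ∀ r ∈ Set.Ioc (0 : ℝ) ρ, ∀ k : ℕ,
      alphaSeq n m H a₀ k r ≤ 1 ∧ betaSeq n m H P c₀ c₁ a₀ k r < ε := by
  obtain ⟨hε₀, hε₁⟩ := hε
  have hb_lim : Filter.Tendsto (bInit n m H a₀) (nhdsWithin 0 (Set.Ioi 0)) (nhds 0) := by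
    have h := ha_lim.const_mul (H * sigm m 0 ^ (-(((m + 1) * sExp n 0 : ℕ) : ℤ)))
    rwa [mul_zero] at h
  set A : ℝ := H + ((m + 2) * m + 1) * (2 * n + 2) * (m + 2)
  set B : ℝ := P + c₁ + |c₀|
  have hsmall : ∀ᶠ r in nhdsWithin (0 : ℝ) (Set.Ioi 0),
      a₀ r < 1 * Real.exp (-(6 * A)) ∧ bInit n m H a₀ r < ε / 2 * Real.exp (-(6 * B)) :=
    (ha_lim.eventually_lt_const (by positivity)).and
      (hb_lim.eventually_lt_const (by positivity))
  obtain ⟨u, hu₀, hu⟩ := mem_nhdsGT_iff_exists_Ioc_subset.mp hsmall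
  refine ⟨min u (1 / 2), ⟨lt_min hu₀ (by norm_num), by
    linarith [min_le_right u (1 / 2)]⟩, fun r hr k => ?_⟩
  obtain ⟨har, hbr⟩ := hu ⟨hr.1, hr.2.trans (min_le_left _ _)⟩
  have ha₀ : 0 ≤ a₀ r := ha_nonneg r hr.1 (by linarith [hr.2, min_le_right u (1 / 2)])
  have hb₀ : 0 ≤ bInit n m H a₀ r :=
    mul_nonneg (mul_nonneg hH.le (zpow_nonneg (sigm_pos m 0).le _)) ha₀
  constructor
  · rw [alphaSeq_eq]
    refine pow_two_pow_mul_prod_le (A := A) (by positivity) zero_le_one le_rfl (fun j => ?_)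
      (mul_inv_sigm_pow_nuExp_le n m hH) ha₀ har.le k
    have := sigm_pos m j
    positivity
  · rw [betaSeq_eq]
    refine lt_of_le_of_lt (pow_two_pow_mul_prod_le (A := B) (δ := ε / 2) (by positivity)
      (by linarith) (by linarith) (fun j => by positivity)
      (mul_exp_affine_le c₀ hP hc₁) hb₀ hbr.le k) (by linarith)
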